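/- The set of integers b ≥ 2 for which there exist positive integers y and c with b ≤ c < b² and y⁴ = c·(b² + 1) is infinite. -/

import Mathlib

theorem pell_aux (n : ℕ) : ∃ b s : ℕ, n ≤ b ∧ 682 ≤ b ∧ 61 ≤ s ∧ b ^ 2 + 1 = 125 * s ^ 2 := by
  induction n with
  | zero => exact ⟨682, 61, by norm_num, by norm_num, by norm_num, by norm_num⟩
  | succ n ih =>
    obtain ⟨b, s, h1, h2, h3, h4⟩ := ih
    refine ⟨930249 * b + 10400500 * s, 930249 * s + 83204 * b, by omega, by omega, by omega, ?_⟩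
    zify at h4 ⊢
    linear_combination h4

theorem infinitely_many_bases_422 :
    {b : ℕ | 2 ≤ b ∧ ∃ y c : ℕ, 0 < y ∧ 0 < c ∧ b ≤ c ∧ c < b ^ 2 ∧
      y ^ 4 = c * (b ^ 2 + 1)}.Infinite := by
  rw [Set.infinite_iff_exists_gt]
  intro n
  obtain ⟨b, s, h1, h2, h3, h4⟩ := pell_aux (n + 1)
  refine ⟨b, ⟨by omega, 5 * s, 5 * s ^ 2, by omega, by positivity, ?_, ?_, ?_⟩, by omega⟩
  · nlinarith
  · nlinarith
  · rw [h4]; ring
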